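/- From the position P2, placing a chap at d5 is Alfred's unique non-losing move: after Alfred places a chap at d5, Betty has no winning strategy from the resulting position, while after every other legal move of Alfred from P2, Betty has a winning strategy from the resulting position. -/

import Mathlib

/-!
Formalization of Philosophers' Phutball on an `m × n` board (`m` rows, `n` columns).
Points are pairs `(column, row)` of integers, with columns `1, …, n` (a, b, c, …)
and rows `1, …, m` (bottom to top).  Player `true` is Alfred (first player, aims
for the top row `m`); player `false` is Betty (aims for the bottom row `1`).
-/

/-- A player: `true` is Alfred, `false` is Betty. -/
abbrev Player := Bool

/-- A Phutball position: the ball's point `(column, row)`, the finite set of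
chaps, and the player whose turn it is. -/
structure PState where
  ball : ℤ × ℤ
  chaps : Finset (ℤ × ℤ)
  turn : Player
deriving DecidableEq

/-- The eight horizontal, vertical and diagonal directions. -/
def dirs : Finset (ℤ × ℤ) :=
  {(1, 0), (1, 1), (0, 1), (-1, 1), (-1, 0), (-1, -1), (0, -1), (1, -1)}

/-- The point reached from `b` after `i` steps in direction `d`. -/
def ray (b d : ℤ × ℤ) (i : ℤ) : ℤ × ℤ := (b.1 + i * d.1, b.2 + i * d.2)

/-- A point is on the `m × n` board. -/
def OnBoard (m n : ℤ) (p : ℤ × ℤ) : Prop :=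
  1 ≤ p.1 ∧ p.1 ≤ n ∧ 1 ≤ p.2 ∧ p.2 ≤ m

/-- A single hop on a board with `n` columns: the ball at `b` moves in one of the
eight directions `d` over a contiguous nonempty line of `k` chaps, landing on the
first point beyond them that carries no chap; the jumped-over chaps are removed.
The landing point must not lie onto or past the sidelines (outside columns
`1, …, n`), but it may lie past the top or bottom row. -/
def Hop (n : ℤ) (b : ℤ × ℤ) (c : Finset (ℤ × ℤ)) (b' : ℤ × ℤ) (c' : Finset (ℤ × ℤ)) : Prop :=
  ∃ d ∈ dirs, ∃ k : ℕ, 1 ≤ k ∧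
    (∀ i : ℕ, 1 ≤ i → i ≤ k → ray b d i ∈ c) ∧
    ray b d (k + 1) ∉ c ∧
    1 ≤ (ray b d (k + 1)).1 ∧ (ray b d (k + 1)).1 ≤ n ∧
    b' = ray b d (k + 1) ∧
    c' = c \ Finset.image (fun i : ℕ => ray b d i) (Finset.Icc 1 k)

/-- A jump is a nonempty sequence of hops (the player may stop after any hop,
and the removed chaps cannot be re-used by later hops of the same jump).  The
jump can continue after a hop only if the ball has not been carried past the top
or bottom row (which would end the game immediately). -/
inductive Jump (m n : ℤ) : ℤ × ℤ → Finset (ℤ × ℤ) → ℤ × ℤ → Finset (ℤ × ℤ) → Prop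
  | single {b c b' c'} : Hop n b c b' c' → Jump m n b c b' c'
  | cons {b c b₁ c₁ b' c'} : Hop n b c b₁ c₁ → 1 ≤ b₁.2 → b₁.2 ≤ m →
      Jump m n b₁ c₁ b' c' → Jump m n b c b' c'

/-- The winner, if any, of a position (evaluated between turns): Alfred wins if
the ball rests on the top row `m` or has been carried past it; Betty wins if the
ball rests on the bottom row `1` or has been carried past it. -/
def winner (m : ℤ) (s : PState) : Option Player :=
  if m ≤ s.ball.2 then some true else if s.ball.2 ≤ 1 then some false else none

/-- A single legal move on the `m × n` board: the player to move either places a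
chap on a vacant on-board point, or moves the ball by a jump; the turn passes to
the other player. -/
def MoveRel (m n : ℤ) (s t : PState) : Prop :=
  t.turn = !s.turn ∧
    ((∃ p, OnBoard m n p ∧ p ∉ s.chaps ∧ p ≠ s.ball ∧
        t.ball = s.ball ∧ t.chaps = insert p s.chaps) ∨
      Jump m n s.ball s.chaps t.ball t.chaps)

/-- An infinite record of play: while the game is not over and a legal move
exists, a legal move is made; otherwise the position is frozen forever. -/
def IsPlay (m n : ℤ) (f : ℕ → PState) : Prop :=
  ∀ k,
    (winner m (f k) = none ∧ (∃ t, MoveRel m n (f k) t) ∧ MoveRel m n (f k) (f (k + 1))) ∨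
    ((winner m (f k) ≠ none ∨ ¬ ∃ t, MoveRel m n (f k) t) ∧ f (k + 1) = f k)

/-- A strategy for player `p` that always proposes a legal move whenever the game
is not over, it is `p`'s turn, and some legal move exists. -/
def LegalStrategy (m n : ℤ) (p : Player) (σ : PState → PState) : Prop :=
  ∀ s, s.turn = p → winner m s = none → (∃ t, MoveRel m n s t) → MoveRel m n s (σ s)

/-- The play `f` follows the strategy `σ` of player `p`. -/
def Follows (m n : ℤ) (p : Player) (σ : PState → PState) (f : ℕ → PState) : Prop :=
  ∀ k, (f k).turn = p → winner m (f k) = none → (∃ t, MoveRel m n (f k) t) →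
    f (k + 1) = σ (f k)

/-- Player `p` has a winning strategy from `s₀` on the `m × n` board: a legal
strategy guaranteeing that, against every play of the opponent, `p` wins after
finitely many moves. -/
def WinsFrom (m n : ℤ) (p : Player) (s₀ : PState) : Prop :=
  ∃ σ, LegalStrategy m n p σ ∧
    ∀ f, IsPlay m n f → f 0 = s₀ → Follows m n p σ f → ∃ k, winner m (f k) = some p

/-- Player `p` has a drawing strategy from `s₀` on the `m × n` board: a legal
strategy guaranteeing that the opponent never wins (play may continue forever). -/
def DrawsFrom (m n : ℤ) (p : Player) (s₀ : PState) : Prop :=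
  ∃ σ, LegalStrategy m n p σ ∧
    ∀ f, IsPlay m n f → f 0 = s₀ → Follows m n p σ f → ∀ k, winner m (f k) ≠ some (!p)

/-- A position is drawn if both players have drawing strategies from it. -/
def Drawn (m n : ℤ) (s : PState) : Prop :=
  DrawsFrom m n true s ∧ DrawsFrom m n false s

/-- The 24 chaps of the position `P0` on the 12 × 10 board:
c1, c2, c5, c7, c9, c10, c11, c12, d6, e4, e11, e12, f1, f2, f9, g7,
h1, h2, h3, h4, h6, h8, h11, h12. -/
def P0chaps : Finset (ℤ × ℤ) :=
  {(3, 1), (3, 2), (3, 5), (3, 7), (3, 9), (3, 10), (3, 11), (3, 12), (4, 6), (5, 4), (5, 11), (5, 12), (6, 1), (6, 2), (6, 9), (7, 7), (8, 1), (8, 2), (8, 3), (8, 4), (8, 6), (8, 8), (8, 11), (8, 12)}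

/-- The position `P0`: ball at a2 = (1, 2), the 24 chaps above, Alfred to move. -/
def P0 : PState := ⟨(1, 2), P0chaps, true⟩

/-- The position `P2`: `P0` with additional chaps at b3, c4, with Alfred to move. -/
def P2 : PState := ⟨(1, 2), P0chaps ∪ {(2, 3), (3, 4)}, true⟩

/-- The result of Alfred placing a chap at d5 = (4, 5) from `P2`. -/
def P2_d5 : PState := ⟨(1, 2), insert (4, 5) P2.chaps, false⟩

namespace Phutball

/-! ### Forcing and strategies -/

section Forcing

variable {m n : ℤ} {p : Player} {G : Set PState}

/-- From the position, player `p` can force a win or a position of `G` within `k` turns. -/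
inductive ForcesIn (m n : ℤ) (p : Player) (G : Set PState) : ℕ → PState → Prop
  | goal {k s} : s ∈ G → ForcesIn m n p G k s
  | won {k s} : winner m s = some p → ForcesIn m n p G k s
  | own {k s t} : s.turn = p → winner m s = none → MoveRel m n s t →
      ForcesIn m n p G k t → ForcesIn m n p G (k + 1) s
  | opp {k s} : s.turn = !p → winner m s = none → (∃ t, MoveRel m n s t) →
      (∀ t, MoveRel m n s t → ForcesIn m n p G k t) → ForcesIn m n p G (k + 1) s

theorem ForcesIn.mono {k l : ℕ} {s : PState} (h : ForcesIn m n p G k s) (hkl : k ≤ l) :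
    ForcesIn m n p G l s := by
  induction h generalizing l with
  | goal h => exact .goal h
  | won h => exact .won h
  | own ht hw hm _ ih =>
    obtain ⟨l, rfl⟩ : ∃ l', l = l' + 1 := ⟨l - 1, by omega⟩
    exact .own ht hw hm (ih (by omega))
  | opp ht hw he _ ih =>
    obtain ⟨l, rfl⟩ : ∃ l', l = l' + 1 := ⟨l - 1, by omega⟩
    exact .opp ht hw he fun t h => ih t h (by omega)

open Classical in
/-- The strategy that moves to a position from which the win can be forced soonest. -/
noncomputable def bestMove (m n : ℤ) (p : Player) (s : PState) : PState :=
  if h : ∃ k t, MoveRel m n s t ∧ ForcesIn m n p ∅ k t then (Nat.find_spec h).choose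
  else if h : ∃ t, MoveRel m n s t then h.choose else s

open Classical in
theorem legalStrategy_bestMove : LegalStrategy m n p (bestMove m n p) := by
  intro s _ _ hex
  unfold bestMove
  split_ifs with h
  · exact (Nat.find_spec (p := fun k => ∃ t, MoveRel m n s t ∧ ForcesIn m n p ∅ k t)
      h).choose_spec.1
  · exact hex.choose_spec

open Classical in
theorem ForcesIn.bestMove {k : ℕ} {s t : PState} (hm : MoveRel m n s t)
    (ht : ForcesIn m n p ∅ k t) : ForcesIn m n p ∅ k (bestMove m n p s) := by
  have h : ∃ k t, MoveRel m n s t ∧ ForcesIn m n p ∅ k t := ⟨k, t, hm, ht⟩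
  rw [Phutball.bestMove, dif_pos h]
  exact (Nat.find_spec h).choose_spec.2.mono (Nat.find_min' h ⟨t, hm, ht⟩)

theorem ForcesIn.winsFrom {k : ℕ} {s : PState} (h : ForcesIn m n p ∅ k s) :
    WinsFrom m n p s := by
  refine ⟨Phutball.bestMove m n p, legalStrategy_bestMove, fun f hf h0 hσ => ?_⟩
  suffices H : ∀ k j, ForcesIn m n p ∅ k (f j) → ∃ i, winner m (f i) = some p from
    H k 0 (h0 ▸ h)
  intro k
  induction k with
  | zero =>
    intro j hj
    cases hj with
    | goal h => exact h.elim
    | won h => exact ⟨j, h⟩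
  | succ k ih =>
    intro j hj
    cases hj with
    | goal h => exact h.elim
    | won h => exact ⟨j, h⟩
    | own ht hw hm h =>
      refine ih (j + 1) ?_
      rw [hσ j ht hw ⟨_, hm⟩]
      exact h.bestMove hm
    | opp ht hw he h =>
      rcases hf j with ⟨_, _, hm⟩ | ⟨hn, _⟩
      · exact ih (j + 1) (h _ hm)
      · exact (hn.elim (· hw) (· he)).elim

/-- If player `p` can, from every position of `G`, move to a position from which he forces a win
or a return to `G`, then the opponent does not win from a position from which `p` forces `G`. -/
theorem ForcesIn.not_winsFrom
    (hG : ∀ x ∈ G, x.turn = p ∧ winner m x = none ∧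
      ∃ t, MoveRel m n x t ∧ ∃ k, ForcesIn m n p G k t)
    {k : ℕ} {s : PState} (h : ForcesIn m n p G k s) : ¬ WinsFrom m n (!p) s := by
  classical
  rintro ⟨σ, hlegal, hwin⟩
  let I : Set PState := {x | ∃ k, ForcesIn m n p G k x}
  let next : PState → PState := fun x =>
    if winner m x = none ∧ ∃ t, MoveRel m n x t then
      if x.turn = !p then σ x
      else if h : ∃ t, MoveRel m n x t ∧ t ∈ I then h.choose else x
    else x
  let f : ℕ → PState := fun k => next^[k] s
  have hsucc : ∀ k, f (k + 1) = next (f k) := fun k => Function.iterate_succ_apply' next k s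
  have hstep : ∀ x ∈ I, winner m x = none → (∃ t, MoveRel m n x t) →
      MoveRel m n x (next x) ∧ next x ∈ I := by
    intro x hx hw he
    simp only [next, if_pos (And.intro hw he)]
    have hown : x.turn = p → (∃ t, MoveRel m n x t ∧ t ∈ I) →
        MoveRel m n x (if x.turn = !p then σ x else
          if h : ∃ t, MoveRel m n x t ∧ t ∈ I then h.choose else x) ∧
        (if x.turn = !p then σ x else
          if h : ∃ t, MoveRel m n x t ∧ t ∈ I then h.choose else x) ∈ I := by
      intro ht h
      rw [if_neg (by simp [ht]), dif_pos h]
      exact h.choose_spec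
    obtain ⟨k, hk⟩ := hx
    cases hk with
    | goal h =>
      obtain ⟨ht, _, h⟩ := hG x h
      exact hown ht h
    | won h => simp [hw] at h
    | own ht _ hm h => exact hown ht ⟨_, hm, _, h⟩
    | opp ht _ _ h =>
      rw [if_pos ht]
      have hm := hlegal x ht hw he
      exact ⟨hm, _, h _ hm⟩
  have hfix : ∀ x, (winner m x ≠ none ∨ ¬ ∃ t, MoveRel m n x t) → next x = x := by
    intro x hx
    exact if_neg (by tauto)
  have hI : ∀ k, f k ∈ I := by
    intro k
    induction k with
    | zero => exact ⟨_, h⟩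
    | succ k ih =>
      rw [hsucc]
      by_cases hc : winner m (f k) = none ∧ ∃ t, MoveRel m n (f k) t
      · exact (hstep _ ih hc.1 hc.2).2
      · rw [hfix _ (by tauto)]
        exact ih
  have hplay : IsPlay m n f := by
    intro k
    by_cases hc : winner m (f k) = none ∧ ∃ t, MoveRel m n (f k) t
    · exact .inl ⟨hc.1, hc.2, hsucc k ▸ (hstep _ (hI k) hc.1 hc.2).1⟩
    · have hc' : winner m (f k) ≠ none ∨ ¬ ∃ t, MoveRel m n (f k) t := by tauto
      exact .inr ⟨hc', (hsucc k).trans (hfix _ hc')⟩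
  have hfollows : Follows m n (!p) σ f := by
    intro k ht hw he
    rw [hsucc]
    simp only [next, if_pos (And.intro hw he), if_pos ht]
  obtain ⟨k, hk⟩ := hwin f hplay rfl hfollows
  obtain ⟨j, hj⟩ := hI k
  cases hj with
  | goal h => simp [(hG _ h).2.1] at hk
  | won h => simp [hk] at h
  | own _ hw => simp [hk] at hw
  | opp _ hw => simp [hk] at hw

end Forcing

/-! ### Bitboards

The point in column `c` and row `r` of the 12 × 10 board, or of the frame around it, is encoded by
`16 * r + c`, and a set of such points by the natural number with these bits. -/

/-- The point with code `i`. -/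
def cell (i : ℕ) : ℤ × ℤ := ((i % 16 : ℕ), (i / 16 : ℕ))

/-- The code of the point in column `c` and row `r`. -/
def code (c r : ℕ) : ℕ := 16 * r + c

/-- The code of a set of points given by their columns and rows. -/
def mask (l : List (ℕ × ℕ)) : ℕ := l.foldr (fun x O => 2 ^ code x.1 x.2 ||| O) 0

/-- The direction with code `d`; a step in this direction adds `d - 17` to the code of a point. -/
def dirOf (d : ℕ) : ℤ × ℤ := ((d % 16 : ℕ) - 1, (d / 16 : ℕ) - 1)

def east : ℕ := 18
def northeast : ℕ := 34
def north : ℕ := 33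
def northwest : ℕ := 32
def west : ℕ := 16
def southwest : ℕ := 0
def south : ℕ := 1
def southeast : ℕ := 2

/-- The codes of the eight directions. -/
def dirCodes : List ℕ :=
  [east, northeast, north, northwest, west, southwest, south, southeast]

/-- The point with code `i` lies between the sidelines. -/
def inColumns (i : ℕ) : Bool := Nat.ble 1 (i % 16) && Nat.ble (i % 16) 10

/-- The point with code `i` is on the board. -/
def inside (i : ℕ) : Bool := inColumns i && (Nat.ble 1 (i / 16) && Nat.ble (i / 16) 12)

/-- The set of all points of the board. -/
def board : ℕ := 2046 * ((2 ^ 208 - 2 ^ 16) / (2 ^ 16 - 1))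

theorem inColumns_iff {i : ℕ} : inColumns i = true ↔ 1 ≤ (cell i).1 ∧ (cell i).1 ≤ 10 := by
  simp only [inColumns, cell, Bool.and_eq_true, Nat.ble_eq]
  omega

theorem inside_iff {i : ℕ} : inside i = true ↔ OnBoard 12 10 (cell i) := by
  simp only [inside, OnBoard, Bool.and_eq_true, inColumns_iff, Nat.ble_eq]
  simp only [cell]
  omega

theorem cell_injective : Function.Injective cell := by
  intro i j h
  simp only [cell, Prod.mk.injEq] at h
  omega

theorem exists_code {x : ℤ × ℤ} (hx : OnBoard 12 10 x) : ∃ i, inside i = true ∧ cell i = x := by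
  obtain ⟨h1, h2, h3, h4⟩ := hx
  have h : cell (code x.1.toNat x.2.toNat) = x := by
    ext <;> simp only [cell, code] <;> omega
  exact ⟨_, by rw [inside_iff, h]; exact ⟨h1, h2, h3, h4⟩, h⟩

theorem testBit_board {i : ℕ} : board.testBit i = inside i := by
  by_cases hi : i < 208
  · have h : ∀ i < 208, board.testBit i = inside i := by decide +kernel
    exact h i hi
  · rw [Nat.testBit_lt_two_pow ((by decide +kernel : board < 2 ^ 208).trans_le
      (Nat.pow_le_pow_right (by norm_num) (by omega)))]
    symm
    rw [← Bool.not_eq_true]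
    simp only [inside, Bool.and_eq_true, Nat.ble_eq]
    omega

theorem dirOf_mem_dirs {d : ℕ} (hd : d ∈ dirCodes) : dirOf d ∈ dirs := by
  revert d
  decide

theorem exists_dirCode {δ : ℤ × ℤ} (hδ : δ ∈ dirs) : ∃ d ∈ dirCodes, dirOf d = δ := by
  revert δ
  decide

theorem dirOf_ne_zero {d : ℕ} (hd : d ∈ dirCodes) : dirOf d ≠ 0 := by
  revert d
  decide

theorem ray_injective {b δ : ℤ × ℤ} (hδ : δ ≠ 0) : Function.Injective (ray b δ) := by
  intro i j h
  simp only [ray, Prod.mk.injEq, add_right_inj, mul_eq_mul_right_iff] at h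
  by_contra hij
  exact hδ (Prod.ext (h.1.resolve_left hij) (h.2.resolve_left hij))

theorem cell_step {i d : ℕ} (hi : inside i = true) (hd : d ∈ dirCodes) :
    cell (i + d - 17) = ((cell i).1 + (dirOf d).1, (cell i).2 + (dirOf d).2) := by
  rw [inside_iff] at hi
  obtain ⟨h1, h2, h3, h4⟩ := hi
  simp only [cell] at h1 h2 h3 h4
  simp only [dirCodes, east, northeast, north, northwest, west, southwest, south, southeast,
    List.mem_cons, List.not_mem_nil, or_false] at hd
  rcases hd with rfl | rfl | rfl | rfl | rfl | rfl | rfl | rfl <;>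
    ext <;> simp only [cell, dirOf] <;> omega

/-- The chaps of a position contain the points of `O` and avoid those of `R`. -/
structure Fits (O R : ℕ) (C : Finset (ℤ × ℤ)) : Prop where
  onBoard : ∀ x ∈ C, OnBoard 12 10 x
  sub : ∀ i, O.testBit i = true → cell i ∈ C
  avoid : ∀ i, R.testBit i = true → cell i ∉ C

theorem Fits.anti {O R R' : ℕ} {C : Finset (ℤ × ℤ)} (h : Fits O R C)
    (hR : ∀ i, R'.testBit i = true → R.testBit i = true) : Fits O R' C :=
  ⟨h.onBoard, h.sub, fun i hi => h.avoid i (hR i hi)⟩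

theorem Fits.or_left {O R R' : ℕ} {C : Finset (ℤ × ℤ)} (h : Fits O (R ||| R') C) : Fits O R C :=
  h.anti fun i hi => by simp [hi]

theorem Fits.or_right {O R R' : ℕ} {C : Finset (ℤ × ℤ)} (h : Fits O (R ||| R') C) : Fits O R' C :=
  h.anti fun i hi => by simp [hi]

theorem Fits.insert {O R e : ℕ} {C : Finset (ℤ × ℤ)} (h : Fits O R C) (he : inside e = true)
    (hR : R.testBit e = false) : Fits O R (Insert.insert (cell e) C) where
  onBoard x hx := by
    rcases Finset.mem_insert.1 hx with rfl | hx
    · exact inside_iff.1 he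
    · exact h.onBoard x hx
  sub i hi := Finset.mem_insert_of_mem (h.sub i hi)
  avoid i hi hx := by
    rcases Finset.mem_insert.1 hx with hx | hx
    · rw [cell_injective hx, hR] at hi
      exact absurd hi (by simp)
    · exact h.avoid i hi hx

/-! ### Hops on bitboards -/

/-- Slide from `i` in direction `d` along the points of `O`, removing them; the value is the
point reached and the set of the remaining points. -/
def sweep : ℕ → ℕ → ℕ → ℕ → ℕ × ℕ
  | 0, i, _, O => (i, O)
  | n + 1, i, d, O => if O.testBit i then sweep n (i + d - 17) d (O ^^^ 2 ^ i) else (i, O)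

theorem sweep_spec {b d : ℕ} (hd : d ∈ dirCodes) {C : Finset (ℤ × ℤ)}
    (hC : ∀ x ∈ C, OnBoard 12 10 x) (n : ℕ) : ∀ (i O k₀ : ℕ),
    (∀ i, O.testBit i = true → cell i ∈ C) → cell i = ray (cell b) (dirOf d) (k₀ + 1) →
    ∃ k, k₀ ≤ k ∧ cell (sweep n i d O).1 = ray (cell b) (dirOf d) (k + 1) ∧
      (∀ t : ℕ, k₀ < t → t ≤ k → ray (cell b) (dirOf d) t ∈ C) ∧
      ∀ x, (O.testBit x = true → (sweep n i d O).2.testBit x = false →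
          ∃ t : ℕ, k₀ < t ∧ t ≤ k ∧ cell x = ray (cell b) (dirOf d) t) ∧
        ((sweep n i d O).2.testBit x = true → O.testBit x = true ∧
          ∀ t : ℕ, k₀ < t → t ≤ k → cell x ≠ ray (cell b) (dirOf d) t) := by
  induction n with
  | zero =>
    intro i O k₀ _ hi
    exact ⟨k₀, le_rfl, hi, fun t h h' => by omega, fun x => ⟨fun h h' => by simp_all [sweep],
      fun hx => ⟨hx, fun t h h' => by omega⟩⟩⟩
  | succ n ih =>
    intro i O k₀ hO hi
    by_cases hbit : O.testBit i = true
    · have hx : ∀ x, (O ^^^ 2 ^ i).testBit x = true → O.testBit x = true ∧ x ≠ i := by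
        intro x hx
        rw [Nat.testBit_xor, Nat.testBit_two_pow] at hx
        by_cases hxi : i = x
        · subst hxi
          simp [hbit] at hx
        · simp only [hxi, decide_false, Bool.xor_false] at hx
          exact ⟨hx, Ne.symm hxi⟩
      obtain ⟨k, hk, h1, h2, h3⟩ := ih (i + d - 17) (O ^^^ 2 ^ i) (k₀ + 1)
        (fun x h => hO x (hx x h).1) (by
          rw [cell_step (inside_iff.2 (hC _ (hO i hbit))) hd, hi]
          simp only [ray, Prod.mk.injEq]
          push_cast
          constructor <;> ring)
      refine ⟨k, by omega, ?_⟩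
      simp only [sweep, hbit, if_true]
      refine ⟨h1, fun t ht ht' => ?_, fun x => ⟨fun h h' => ?_, fun h => ?_⟩⟩
      · rcases eq_or_lt_of_le (Nat.succ_le_of_lt ht) with rfl | ht
        · have := hO i hbit
          rw [hi] at this
          exact_mod_cast this
        · exact h2 t ht ht'
      · by_cases hxi : x = i
        · subst hxi
          exact ⟨k₀ + 1, by omega, hk, by rw [hi]; push_cast; rfl⟩
        · obtain ⟨t, ht, ht', hxt⟩ := (h3 x).1 (by simp [h, Ne.symm hxi]) h'
          exact ⟨t, by omega, ht', hxt⟩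
      · obtain ⟨h4, h5⟩ := (h3 x).2 h
        obtain ⟨h6, h7⟩ := hx x h4
        refine ⟨h6, fun t ht ht' => ?_⟩
        rcases eq_or_lt_of_le (Nat.succ_le_of_lt ht) with rfl | ht
        · intro h8
          refine h7 (cell_injective (h8.trans ?_))
          rw [hi]
          push_cast
          rfl
        · exact h5 t ht ht'
    · refine ⟨k₀, le_rfl, ?_⟩
      simp only [sweep, hbit]
      exact ⟨hi, fun t h h' => by omega, fun x => ⟨fun h h' => by simp_all,
        fun hx => ⟨hx, fun t h h' => by omega⟩⟩⟩

/-- The result of a hop in direction `d` of a ball at `b`. -/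
def hopTo (b d O : ℕ) : ℕ × ℕ := sweep 12 (b + d - 17) d O

/-- There is a hop in direction `d` of a ball at `b`. -/
def canHop (b d O : ℕ) : Bool :=
  !Nat.beq (hopTo b d O).1 (b + d - 17) && inColumns (hopTo b d O).1

/-- The points jumped over in the hop in direction `d` of a ball at `b`. -/
def jumped (b d O : ℕ) : ℕ := O ^^^ (hopTo b d O).2

/-- The points that have to be vacant before the hop in direction `d` of a ball at `b` if those of
`R` have to be vacant after it. -/
def unhop (b d O R : ℕ) : ℕ := 2 ^ (hopTo b d O).1 ||| ((R ||| jumped b d O) ^^^ jumped b d O)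

theorem testBit_unhop {b d O R i : ℕ} (hi : R.testBit i = true)
    (hj : (jumped b d O).testBit i = false) : (unhop b d O R).testBit i = true := by
  simp [unhop, hi, hj]

theorem hopTo_spec {b d O R : ℕ} (hd : d ∈ dirCodes) (hb : inside b = true)
    {C : Finset (ℤ × ℤ)} (h : Fits O (unhop b d O R) C) :
    ∃ k : ℕ, cell (hopTo b d O).1 = ray (cell b) (dirOf d) (k + 1) ∧
      (∀ t : ℕ, 1 ≤ t → t ≤ k → ray (cell b) (dirOf d) t ∈ C) ∧
      ray (cell b) (dirOf d) (k + 1) ∉ C ∧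
      (canHop b d O = true ↔ 1 ≤ k ∧ 1 ≤ (ray (cell b) (dirOf d) (k + 1)).1 ∧
        (ray (cell b) (dirOf d) (k + 1)).1 ≤ 10) ∧
      Fits (hopTo b d O).2 R
        (C \ Finset.image (fun i : ℕ => ray (cell b) (dirOf d) i) (Finset.Icc 1 k)) := by
  have hstart : cell (b + d - 17) = ray (cell b) (dirOf d) ((0 : ℕ) + 1) := by
    rw [cell_step hb hd]
    simp [ray]
  obtain ⟨k, -, h1, h2, h3⟩ := sweep_spec (b := b) hd h.onBoard 12 (b + d - 17) O 0 h.sub hstart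
  rw [← hopTo] at h1 h3
  refine ⟨k, h1, fun t ht => h2 t ht, ?_, ?_, fun x hx => h.onBoard x (Finset.mem_sdiff.1 hx).1,
    fun i hi => ?_, fun i hi hx => ?_⟩
  · rw [← h1]
    exact h.avoid _ (by simp [unhop])
  · rw [← h1, ← inColumns_iff, canHop, Bool.and_eq_true, Bool.not_eq_true', ← Bool.not_eq_true,
      Nat.beq_eq, ← cell_injective.eq_iff, h1, hstart,
      (ray_injective (dirOf_ne_zero hd)).eq_iff]
    refine and_congr_left fun _ => ?_
    omega
  · obtain ⟨h4, h5⟩ := (h3 i).2 hi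
    refine Finset.mem_sdiff.2 ⟨h.sub i h4, fun hx => ?_⟩
    obtain ⟨t, ht, hti⟩ := Finset.mem_image.1 hx
    rw [Finset.mem_Icc] at ht
    exact h5 t ht.1 ht.2 hti.symm
  · obtain ⟨hxC, hx⟩ := Finset.mem_sdiff.1 hx
    by_cases hj : (jumped b d O).testBit i = false
    · exact h.avoid i (testBit_unhop hi hj) hxC
    · have hO : O.testBit i = true ∧ (hopTo b d O).2.testBit i = false := by
        have := (h3 i).2
        rw [jumped, Nat.testBit_xor] at hj
        revert hj this
        cases O.testBit i <;> cases (hopTo b d O).2.testBit i <;> simp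
      obtain ⟨t, ht, ht', hxt⟩ := (h3 i).1 hO.1 hO.2
      exact hx (Finset.mem_image.2 ⟨t, Finset.mem_Icc.2 ⟨ht, ht'⟩, hxt.symm⟩)

theorem inColumns_of_canHop {b d O : ℕ} (h : canHop b d O = true) :
    inColumns (hopTo b d O).1 = true := by
  rw [canHop, Bool.and_eq_true] at h
  exact h.2

theorem exists_hop {b d O R : ℕ} (hd : d ∈ dirCodes) (hb : inside b = true)
    {C : Finset (ℤ × ℤ)} (h : Fits O (unhop b d O R) C) (hc : canHop b d O = true) :
    ∃ C', Hop 10 (cell b) C (cell (hopTo b d O).1) C' ∧ Fits (hopTo b d O).2 R C' := by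
  obtain ⟨k, h1, h2, h3, h4, h5⟩ := hopTo_spec hd hb h
  obtain ⟨h6, h7, h8⟩ := h4.1 hc
  exact ⟨_, ⟨dirOf d, dirOf_mem_dirs hd, k, h6, h2, h3, h7, h8, h1, rfl⟩, h5⟩

theorem eq_hopTo_of_hop {b O : ℕ} (hb : inside b = true) {C : Finset (ℤ × ℤ)}
    {b' : ℤ × ℤ} {C' : Finset (ℤ × ℤ)} (hop : Hop 10 (cell b) C b' C') :
    ∃ d ∈ dirCodes, ∀ R, Fits O (unhop b d O R) C →
      canHop b d O = true ∧ b' = cell (hopTo b d O).1 ∧ Fits (hopTo b d O).2 R C' := by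
  obtain ⟨δ, hδ, l, hl, hmem, hnot, hc1, hc2, rfl, rfl⟩ := hop
  obtain ⟨d, hd, rfl⟩ := exists_dirCode hδ
  refine ⟨d, hd, fun R h => ?_⟩
  obtain ⟨k, h1, h2, h3, h4, h5⟩ := hopTo_spec hd hb h
  obtain rfl : k = l := by
    rcases lt_trichotomy k l with hkl | hkl | hkl
    · exact absurd (hmem (k + 1) (by omega) (by omega)) (by exact_mod_cast h3)
    · exact hkl
    · exact absurd (h2 (l + 1) (by omega) (by omega)) (by exact_mod_cast hnot)
  exact ⟨h4.2 ⟨hl, hc1, hc2⟩, h1.symm, h5⟩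

/-! ### Checking plans -/

/-- The ball at `b` is on or past the goalline of player `p`. -/
def wonAt (p : Player) (b : ℕ) : Bool :=
  match p with
  | true => Nat.ble 12 (b / 16)
  | false => Nat.ble (b / 16) 1

theorem winner_eq_some {p : Player} {b : ℕ} {C : Finset (ℤ × ℤ)} {q : Player} :
    winner 12 ⟨cell b, C, q⟩ = some p ↔ wonAt p b = true := by
  by_cases h : (12 : ℤ) ≤ (b / 16 : ℕ) <;> by_cases h' : ((b / 16 : ℕ) : ℤ) ≤ 1 <;> cases p <;>
    simp only [winner, cell, wonAt, Nat.ble_eq, h, h', if_true, if_false, Option.some.injEq,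
      reduceCtorEq, Bool.true_eq_false, Bool.false_eq_true, true_iff, false_iff] <;> omega

theorem winner_eq_none {p : Player} {b : ℕ} {C : Finset (ℤ × ℤ)} {q : Player} :
    winner 12 ⟨cell b, C, q⟩ = none ↔ wonAt p b = false ∧ wonAt (!p) b = false := by
  simp only [← Bool.not_eq_true, ← winner_eq_some (C := C) (q := q)]
  cases p <;> generalize winner 12 ⟨cell b, C, q⟩ = w <;> rcases w with _ | _ | _ <;> simp

/-- The union of two sets of points, if both are given. -/
def union : Option ℕ → Option ℕ → Option ℕ
  | some R, some R' => some (R ||| R')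
  | _, _ => none

theorem union_eq_some {x y : Option ℕ} {R : ℕ} :
    union x y = some R ↔ ∃ r s, x = some r ∧ y = some s ∧ r ||| s = R := by
  cases x <;> cases y <;> simp [union]

/-- The union of the sets `f x` for `x` in a list, if all of them are given. -/
def unionAll (f : ℕ → Option ℕ) : List ℕ → Option ℕ
  | [] => some 0
  | x :: l => union (f x) (unionAll f l)

theorem exists_of_unionAll {f : ℕ → Option ℕ} {l : List ℕ} {R : ℕ} (h : unionAll f l = some R)
    {x : ℕ} (hx : x ∈ l) :
    ∃ r, f x = some r ∧ ∀ i, r.testBit i = true → R.testBit i = true := by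
  induction l generalizing R with
  | nil => simp at hx
  | cons y l ih =>
    obtain ⟨r, s, hr, hs, rfl⟩ := union_eq_some.1 h
    rcases List.mem_cons.1 hx with rfl | hx
    · exact ⟨r, hr, fun i hi => by simp [hi]⟩
    · obtain ⟨r', hr', hsub⟩ := ih hs hx
      exact ⟨r', hr', fun i hi => by simp [hsub i hi]⟩

/-- A check of a family of positions with player `p` to move: `ev b O = some R` is meant to show
that every position with the ball at `b` whose chaps contain `O` and avoid `R` satisfies `Q`. -/
def Sound (p : Player) (ev : ℕ → ℕ → Option ℕ) (Q : PState → Prop) : Prop :=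
  ∀ b O R C, ev b O = some R → Fits O R C → inside b = true → wonAt p b = false →
    wonAt (!p) b = false → Q ⟨cell b, C, p⟩

/-- `ev`, except that finished games are decided by the position of the ball. -/
def settle (p : Player) (ev : ℕ → ℕ → Option ℕ) (b O : ℕ) : Option ℕ :=
  if wonAt p b then some 0 else if wonAt (!p) b then none else ev b O

/-- Check `ev` after all jumps of the opponent of `p`. -/
def checkJumps (p : Player) (ev : ℕ → ℕ → Option ℕ) : ℕ → ℕ → ℕ → Option ℕ
  | 0, _, _ => none
  | n + 1, b, O => unionAll (fun d => (if canHop b d O then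
      union (settle p ev (hopTo b d O).1 (hopTo b d O).2)
        (if inside (hopTo b d O).1 then checkJumps p ev n (hopTo b d O).1 (hopTo b d O).2
          else some 0)
      else some 0).map (unhop b d O)) dirCodes

/-- The codes of the points of `R` other than `b` on the board. -/
def codes (b R : ℕ) : List ℕ :=
  (List.range 208).filter fun e => R.testBit e && (inside e && !Nat.beq e b)

/-- A set that contains a point of the board other than `b`. -/
def nonempty (b : ℕ) : Option ℕ → Option ℕ
  | none => none
  | some R => if (codes b R).isEmpty then none else some R

/-- `ev`, except that points of `O` cannot be required to be vacant. -/
def consistent (ev : ℕ → ℕ → Option ℕ) (b O : ℕ) : Option ℕ :=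
  match ev b O with
  | none => none
  | some R => if Nat.beq (O &&& R) 0 then some R else none

/-- Check `ev` after all moves of the opponent of `p`. -/
def checkOpp (p : Player) (ev : ℕ → ℕ → Option ℕ) (b O : ℕ) : Option ℕ :=
  match ev b O with
  | none => none
  | some R => nonempty b <|
      union (some R) (union (unionAll (fun e => consistent ev b (O ||| 2 ^ e)) (codes b R))
        (checkJumps p ev 12 b O))

section Soundness

variable {p : Player} {ev : ℕ → ℕ → Option ℕ} {Q : PState → Prop}

/-- All moves of the opponent of `p`, who is to move, lead to positions satisfying `Q`. -/
structure Lost (p : Player) (Q : PState → Prop) (s : PState) : Prop where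
  turn : s.turn = !p
  undecided : winner 12 s = none
  exists_move : ∃ t, MoveRel 12 10 s t
  forall_move : ∀ t, MoveRel 12 10 s t → Q t

theorem inside_of_not_wonAt {b : ℕ} (hc : inColumns b = true) (h₁ : wonAt p b = false)
    (h₂ : wonAt (!p) b = false) : inside b = true := by
  simp only [inside, hc, Bool.true_and, Bool.and_eq_true, Nat.ble_eq]
  cases p <;> simp only [wonAt, Bool.not_true, Bool.not_false, ← Bool.not_eq_true,
    Nat.ble_eq] at h₁ h₂ <;> omega

theorem settle_sound (hev : Sound p ev Q) (hQ : ∀ t, winner 12 t = some p → Q t) {b O R : ℕ}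
    {C : Finset (ℤ × ℤ)} (h : settle p ev b O = some R) (hC : Fits O R C)
    (hb : inColumns b = true) : Q ⟨cell b, C, p⟩ := by
  unfold settle at h
  split_ifs at h with h₁ h₂
  · exact hQ _ (winner_eq_some.2 h₁)
  · rw [Bool.not_eq_true] at h₁ h₂
    exact hev b O R C h hC (inside_of_not_wonAt hb h₁ h₂) h₁ h₂

theorem checkJumps_sound (hev : Sound p ev Q) (hQ : ∀ t, winner 12 t = some p → Q t)
    {b' : ℤ × ℤ} {C C' : Finset (ℤ × ℤ)} {x : ℤ × ℤ} (hj : Jump 12 10 x C b' C') :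
    ∀ {n b O R : ℕ}, x = cell b → checkJumps p ev n b O = some R → Fits O R C →
      inside b = true → Q ⟨b', C', p⟩ := by
  induction hj with
  | single hop =>
    rintro (_ | n) b O R rfl h hC hb
    · simp [checkJumps] at h
    obtain ⟨d, hd, hfit⟩ := eq_hopTo_of_hop (O := O) hb hop
    obtain ⟨r, hr, hsub⟩ := exists_of_unionAll h hd
    obtain ⟨r', h', rfl⟩ := Option.map_eq_some_iff.1 hr
    obtain ⟨hc, rfl, hfits⟩ := hfit r' (hC.anti hsub)
    rw [if_pos hc] at h'
    obtain ⟨r₁, r₂, h₁, h₂, rfl⟩ := union_eq_some.1 h'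
    exact settle_sound hev hQ h₁ hfits.or_left (inColumns_of_canHop hc)
  | cons hop hlo hhi _ ih =>
    rintro (_ | n) b O R rfl h hC hb
    · simp [checkJumps] at h
    obtain ⟨d, hd, hfit⟩ := eq_hopTo_of_hop (O := O) hb hop
    obtain ⟨r, hr, hsub⟩ := exists_of_unionAll h hd
    obtain ⟨r', h', rfl⟩ := Option.map_eq_some_iff.1 hr
    obtain ⟨hc, rfl, hfits⟩ := hfit r' (hC.anti hsub)
    rw [if_pos hc] at h'
    obtain ⟨r₁, r₂, h₁, h₂, rfl⟩ := union_eq_some.1 h'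
    have hcol := inColumns_iff.1 (inColumns_of_canHop hc)
    have hin : inside (hopTo b d O).1 = true := inside_iff.2 ⟨hcol.1, hcol.2, hlo, hhi⟩
    rw [if_pos hin] at h₂
    exact ih rfl h₂ hfits.or_right hin

theorem mem_codes {b R e : ℕ} :
    e ∈ codes b R ↔ R.testBit e = true ∧ inside e = true ∧ e ≠ b := by
  simp only [codes, List.mem_filter, List.mem_range, Bool.and_eq_true, Bool.not_eq_true',
    ← Bool.not_eq_true, Nat.beq_eq, and_iff_right_iff_imp]
  rintro ⟨-, h, -⟩
  simp only [inside, Bool.and_eq_true, Nat.ble_eq] at h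
  omega

theorem nonempty_eq_some {b R : ℕ} {x : Option ℕ} (h : nonempty b x = some R) :
    x = some R ∧ ∃ e, e ∈ codes b R := by
  unfold nonempty at h
  split at h
  · simp at h
  · split_ifs at h with hne
    cases h
    exact ⟨rfl, List.exists_mem_of_ne_nil _ (by simpa using hne)⟩

theorem consistent_eq_some {b O R : ℕ} (h : consistent ev b O = some R) :
    ev b O = some R ∧ ∀ i, O.testBit i = true → R.testBit i = false := by
  unfold consistent at h
  split at h
  · simp at h
  · next R' hR' =>
    split_ifs at h with h0
    cases h
    refine ⟨hR', fun i hi => ?_⟩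
    have := congrArg (Nat.testBit · i) (Nat.eq_of_beq_eq_true h0)
    simpa [hi] using this

theorem Fits.insert_or {O R e : ℕ} {C : Finset (ℤ × ℤ)} (h : Fits O R C) (he : inside e = true)
    (hR : R.testBit e = false) : Fits (O ||| 2 ^ e) R (Insert.insert (cell e) C) where
  onBoard := (h.insert he hR).onBoard
  sub i hi := by
    rw [Nat.testBit_or, Nat.testBit_two_pow, Bool.or_eq_true, decide_eq_true_eq] at hi
    rcases hi with hi | rfl
    · exact Finset.mem_insert_of_mem (h.sub i hi)
    · exact Finset.mem_insert_self _ _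
  avoid := (h.insert he hR).avoid

theorem checkOpp_sound (hev : Sound p ev Q) (hQ : ∀ t, winner 12 t = some p → Q t) {b O R : ℕ}
    {C : Finset (ℤ × ℤ)} (h : checkOpp p ev b O = some R) (hC : Fits O R C)
    (hb : inside b = true) (h₁ : wonAt p b = false) (h₂ : wonAt (!p) b = false) :
    Lost p Q ⟨cell b, C, !p⟩ := by
  unfold checkOpp at h
  split at h
  · simp at h
  next R₀ hR₀ =>
  obtain ⟨h, e, he⟩ := nonempty_eq_some h
  obtain ⟨_, r, h₀, hr, rfl⟩ := union_eq_some.1 h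
  cases h₀
  obtain ⟨r₁, r₂, hplace, hjump, rfl⟩ := union_eq_some.1 hr
  refine ⟨rfl, winner_eq_none.2 ⟨h₁, h₂⟩, ?_, ?_⟩
  · obtain ⟨he₁, he₂, he₃⟩ := mem_codes.1 he
    exact ⟨⟨cell b, insert (cell e) C, p⟩, (Bool.not_not p).symm, .inl ⟨cell e, inside_iff.1 he₂,
      hC.avoid e he₁, cell_injective.ne he₃, rfl, rfl⟩⟩
  · rintro ⟨b', C', q⟩ ⟨hq, hm⟩
    obtain rfl : q = p := hq.trans (Bool.not_not p)
    rcases hm with ⟨x, hx, hxC, hxb, hb', hC'⟩ | hj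
    · obtain ⟨e, he, rfl⟩ := exists_code hx
      dsimp only at hb' hC' hxC hxb
      subst hb' hC'
      by_cases hR : R₀.testBit e = true
      · obtain ⟨r, hr, hsub⟩ := exists_of_unionAll hplace
          (mem_codes.2 ⟨hR, he, fun h => hxb (congrArg cell h)⟩)
        obtain ⟨hr, hcon⟩ := consistent_eq_some hr
        exact hev b _ r _ hr ((hC.or_right.or_left.anti hsub).insert_or he (hcon e (by simp)))
          hb h₁ h₂
      · exact hev b O R₀ _ hR₀ (hC.or_left.insert he (by simpa using hR)) hb h₁ h₂
    · exact checkJumps_sound hev hQ hj rfl hjump hC.or_right.or_right hb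

end Soundness

/-! ### Plans -/

/-- A move on a bitboard: placing a chap in a given column and row, or a jump whose hops have the
given directions. -/
inductive Mv
  | place (c r : ℕ)
  | jump (ds : List ℕ)

/-- A list of alternatives for a player to move: ending the plan in a position of the goal, or
a move together with the plan to be followed after the reply of the opponent. -/
inductive Plan
  | nil
  | goal (alt : Plan)
  | move (mv : Mv) (next alt : Plan)

namespace Plan

/-- The number of turns needed to carry out a plan. -/
def depth : Plan → ℕ
  | nil => 0
  | goal alt => depth alt
  | move _ next alt => max (depth next + 2) (depth alt)

/-- The alternative of trying the given jumps to win at once. -/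
def wins (jumps : List (List ℕ)) (alt : Plan) : Plan :=
  jumps.foldr (fun ds alt => move (.jump ds) nil alt) alt

end Plan

/-- Check `ev` after the opponent's reply to a jump of `p` with hops in directions `ds`. -/
def checkHops (p : Player) (ev : ℕ → ℕ → Option ℕ) : List ℕ → ℕ → ℕ → Option ℕ
  | [], b, O => settle p (checkOpp p ev) b O
  | d :: ds, b, O =>
    if inside b && (dirCodes.any (Nat.beq d) && canHop b d O) then
      (checkHops p ev ds (hopTo b d O).1 (hopTo b d O).2).map (unhop b d O)
    else none

/-- Check `ev` after the opponent's reply to a move of `p`. -/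
def checkMove (p : Player) (ev : ℕ → ℕ → Option ℕ) (b O : ℕ) : Mv → Option ℕ
  | .place c r =>
    if inside (code c r) && (!Nat.beq (code c r) b && !O.testBit (code c r)) then
      (consistent (checkOpp p ev) b (O ||| 2 ^ code c r)).map (2 ^ code c r ||| ·)
    else none
  | .jump [] => none
  | .jump (d :: ds) => checkHops p ev (d :: ds) b O

/-- Check that player `p`, who is to move, can use the plan to force a win or one of the positions
in `goals`, which are given by the ball and the chaps. -/
def check (p : Player) (goals : List (ℕ × ℕ)) : Plan → ℕ → ℕ → Option ℕ
  | .nil, _, _ => none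
  | .goal alt, b, O =>
    if goals.any fun x => Nat.beq x.1 b && Nat.beq x.2 O then some ((board ||| O) ^^^ O)
    else check p goals alt b O
  | .move mv next alt, b, O =>
    match checkMove p (check p goals next) b O mv with
    | some R => some R
    | none => check p goals alt b O

/-- The points in the set with code `O`. -/
def points (O : ℕ) : Finset (ℤ × ℤ) := ((Finset.range 208).filter (O.testBit ·)).image cell

/-- The position with player `p` to move given by the ball and the chaps. -/
def position (p : Player) (x : ℕ × ℕ) : PState := ⟨cell x.1, points x.2, p⟩

section PlanSoundness

variable {p : Player} {ev : ℕ → ℕ → Option ℕ} {Q : PState → Prop}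

/-- Player `p`, who is to move, has a move after which he has won or the opponent, who is to move,
can only reach positions satisfying `Q`. -/
def CanLeadTo (p : Player) (Q : PState → Prop) (s : PState) : Prop :=
  ∃ t, MoveRel 12 10 s t ∧ (winner 12 t = some p ∨ Lost p Q t)

theorem settle_checkOpp_sound (hev : Sound p ev Q) (hQ : ∀ t, winner 12 t = some p → Q t)
    {b O R : ℕ} {C : Finset (ℤ × ℤ)} (h : settle p (checkOpp p ev) b O = some R)
    (hC : Fits O R C) (hb : inColumns b = true) :
    winner 12 ⟨cell b, C, !p⟩ = some p ∨ Lost p Q ⟨cell b, C, !p⟩ := by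
  unfold settle at h
  split_ifs at h with h₁ h₂
  · exact .inl (winner_eq_some.2 h₁)
  · rw [Bool.not_eq_true] at h₁ h₂
    exact .inr (checkOpp_sound hev hQ h hC (inside_of_not_wonAt hb h₁ h₂) h₁ h₂)

theorem checkHops_sound (hev : Sound p ev Q) (hQ : ∀ t, winner 12 t = some p → Q t)
    {ds : List ℕ} : ∀ {d b O R : ℕ} {C : Finset (ℤ × ℤ)},
    checkHops p ev (d :: ds) b O = some R → Fits O R C →
    ∃ b' C', Jump 12 10 (cell b) C b' C' ∧
      (winner 12 ⟨b', C', !p⟩ = some p ∨ Lost p Q ⟨b', C', !p⟩) := by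
  induction ds with
  | nil =>
    intro d b O R C h hC
    rw [checkHops] at h
    split_ifs at h with hc
    simp only [Bool.and_eq_true, List.any_eq_true, Nat.beq_eq] at hc
    obtain ⟨hb, ⟨_, hd, rfl⟩, hc⟩ := hc
    obtain ⟨r, hr, rfl⟩ := Option.map_eq_some_iff.1 h
    obtain ⟨C', hop, hfits⟩ := exists_hop hd hb hC hc
    exact ⟨_, C', .single hop,
      settle_checkOpp_sound hev hQ hr hfits (inColumns_of_canHop hc)⟩
  | cons d' ds ih =>
    intro d b O R C h hC
    rw [checkHops] at h
    split_ifs at h with hc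
    simp only [Bool.and_eq_true, List.any_eq_true, Nat.beq_eq] at hc
    obtain ⟨hb, ⟨_, hd, rfl⟩, hc⟩ := hc
    obtain ⟨r, hr, rfl⟩ := Option.map_eq_some_iff.1 h
    obtain ⟨C', hop, hfits⟩ := exists_hop hd hb hC hc
    obtain ⟨b'', C'', hjump, hres⟩ := ih hr hfits
    have hin : inside (hopTo b d O).1 = true := by
      rw [checkHops] at hr
      split_ifs at hr with hc'
      rw [Bool.and_eq_true] at hc'
      exact hc'.1
    obtain ⟨-, -, h₁, h₂⟩ := inside_iff.1 hin
    exact ⟨b'', C'', .cons hop h₁ h₂ hjump, hres⟩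

theorem checkMove_sound (hev : Sound p ev Q) (hQ : ∀ t, winner 12 t = some p → Q t) (mv : Mv) :
    Sound p (fun b O => checkMove p ev b O mv) (CanLeadTo p Q) := by
  intro b O R C h hC hb h₁ h₂
  rcases mv with ⟨c, r⟩ | ⟨_ | ⟨d, ds⟩⟩
  · simp only [checkMove] at h
    split_ifs at h with hc
    simp only [Bool.and_eq_true, Bool.not_eq_true', ← Bool.not_eq_true, Nat.beq_eq] at hc
    obtain ⟨hin, hne, -⟩ := hc
    obtain ⟨R, hR, rfl⟩ := Option.map_eq_some_iff.1 h
    obtain ⟨hR, hcon⟩ := consistent_eq_some hR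
    exact ⟨⟨cell b, insert (cell (code c r)) C, !p⟩, ⟨rfl, .inl ⟨_, inside_iff.1 hin,
      hC.avoid _ (by simp), cell_injective.ne hne, rfl, rfl⟩⟩, .inr (checkOpp_sound hev hQ hR
      (hC.or_right.insert_or hin (hcon _ (by simp))) hb h₁ h₂)⟩
  · simp [checkMove] at h
  · obtain ⟨b', C', hjump, hres⟩ := checkHops_sound hev hQ h hC
    exact ⟨⟨b', C', !p⟩, ⟨rfl, .inr hjump⟩, hres⟩

theorem mem_points {O i : ℕ} (hO : O.testBit i = true) (hi : inside i = true) :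
    cell i ∈ points O := by
  refine Finset.mem_image_of_mem _ (Finset.mem_filter.2 ⟨Finset.mem_range.2 ?_, hO⟩)
  simp only [inside, Bool.and_eq_true, Nat.ble_eq] at hi
  omega

theorem exists_of_mem_points {O : ℕ} {x : ℤ × ℤ} (hx : x ∈ points O) :
    ∃ i, O.testBit i = true ∧ cell i = x := by
  obtain ⟨i, hi, rfl⟩ := Finset.mem_image.1 hx
  exact ⟨i, (Finset.mem_filter.1 hi).2, rfl⟩

theorem Fits.eq_points {O : ℕ} {C : Finset (ℤ × ℤ)} (h : Fits O ((board ||| O) ^^^ O) C) :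
    C = points O := by
  ext x
  constructor
  · intro hx
    obtain ⟨i, hi, rfl⟩ := exists_code (h.onBoard x hx)
    by_cases hO : O.testBit i = true
    · exact mem_points hO hi
    · exact absurd hx (h.avoid i (by simp [testBit_board, hi, hO]))
  · intro hx
    obtain ⟨i, hi, rfl⟩ := exists_of_mem_points hx
    exact h.sub i hi

theorem fits_points {O R : ℕ} (hO : board ||| O = board)
    (hR : ∀ i, O.testBit i = true → R.testBit i = false) : Fits O R (points O) where
  onBoard x hx := by
    obtain ⟨i, hi, rfl⟩ := exists_of_mem_points hx
    rw [← inside_iff, ← testBit_board, ← hO]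
    simp [hi]
  sub i hi := by
    refine mem_points hi ?_
    rw [← testBit_board, ← hO]
    simp [hi]
  avoid i hi hx := by
    obtain ⟨j, hj, hji⟩ := exists_of_mem_points hx
    rw [← cell_injective hji, hR j hj] at hi
    exact absurd hi (by simp)

theorem Lost.forcesIn {G : Set PState} {k : ℕ} {s : PState}
    (h : Lost p (ForcesIn 12 10 p G k) s) : ForcesIn 12 10 p G (k + 1) s :=
  .opp h.turn h.undecided h.exists_move h.forall_move

theorem CanLeadTo.exists_forcesIn {G : Set PState} {k : ℕ} {s : PState}
    (h : CanLeadTo p (ForcesIn 12 10 p G k) s) :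
    ∃ t, MoveRel 12 10 s t ∧ ForcesIn 12 10 p G (k + 1) t := by
  obtain ⟨t, hm, ht | ht⟩ := h
  exacts [⟨t, hm, .won ht⟩, ⟨t, hm, ht.forcesIn⟩]

/-- The positions with player `p` to move in a list. -/
def positions (p : Player) (goals : List (ℕ × ℕ)) : Set PState :=
  {s | ∃ x ∈ goals, s = position p x}

theorem check_sound (goals : List (ℕ × ℕ)) (plan : Plan) :
    Sound p (check p goals plan) (ForcesIn 12 10 p (positions p goals) plan.depth) := by
  induction plan with
  | nil => intro b O R C h; simp [check] at h
  | goal alt ih =>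
    intro b O R C h hC hb h₁ h₂
    rw [check] at h
    split_ifs at h with hg
    · cases h
      simp only [List.any_eq_true, Bool.and_eq_true, Nat.beq_eq] at hg
      obtain ⟨x, hx, rfl, rfl⟩ := hg
      exact .goal ⟨x, hx, by rw [hC.eq_points]; rfl⟩
    · exact ih b O R C h hC hb h₁ h₂
  | move mv next alt ihn iha =>
    intro b O R C h hC hb h₁ h₂
    rw [check] at h
    split at h
    next R' hR =>
      cases h
      obtain ⟨t, hm, ht⟩ := (checkMove_sound ihn (fun _ => .won) mv b O R C hR hC hb h₁
        h₂).exists_forcesIn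
      exact (ForcesIn.own rfl (winner_eq_none.2 ⟨h₁, h₂⟩) hm ht).mono (le_max_left _ _)
    · exact (iha b O R C h hC hb h₁ h₂).mono (le_max_right _ _)

end PlanSoundness

/-! ### The loop -/

section Loop

open Plan

local notation "e" => east
local notation "ne" => northeast
local notation "n" => north
local notation "nw" => northwest
local notation "w" => west
local notation "sw" => southwest
local notation "s" => south
local notation "se" => southeast

/-- Alfred's plan if a hop in direction `d` leads to c4. -/
def threatC4 (d : ℕ) (mid : Plan → Plan) : Plan :=
  wins [[d, n, n, n]] <| mid <| wins [[d, n, n], [n, n, n], [n, n]] <|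
  move (.place 4 6) (wins [[w, n, n], [w, ne, nw, ne], [w, n], [n, n], [n]] nil) <|
  wins [[n]] nil

/-- Alfred's plan if a hop in direction `d` leads to e6. -/
def threatE6 (d : ℕ) (mid : Plan → Plan) : Plan :=
  wins [[d, w, n, n], [d, w, ne, nw, ne]] <| mid <|
  wins [[d, w, n], [w, n, n], [n, n], [n]] <|
  move (.place 3 5) (wins [[n, n, n], [n, n], [n]] nil) nil

/-- Alfred's plan if a hop in direction `d` leads to g8. -/
def threatG8 (d : ℕ) (mid : Plan → Plan) : Plan :=
  wins [[d, nw, n]] <| mid <| wins [[d, nw, ne], [nw, n]] <|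
  move (.place 9 9) (wins [[n, nw], [nw]] nil) <|
  wins [[n]] <|
  move (.place 8 7)
    (wins [[e, nw, nw, n], [ne, w, nw, n], [e, nw, n], [e, nw, nw, ne], [nw, nw, n], [nw, n]] <|
      move (.place 9 9) (wins [[n, nw], [nw]] nil) <|
      wins [[n], [w, nw, n], [nw, nw, ne]] nil) nil

/-- Alfred's plan if a hop northeast leads to i10. -/
def threatI10 (mid : Plan → Plan) : Plan := wins [[ne, nw]] <| mid <| wins [[nw]] nil

/-- Alfred's plan after jumping to j11. -/
def afterJump : Plan :=
  move (.place 9 12)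
    (wins [[nw]] <| move (.place 10 10) (wins [[n, nw], [n], [nw]] nil) nil) <|
  goal <| wins [[w, ne], [nw]] nil

/-- Alfred's plan after closing the loop. -/
def afterLoop : Plan :=
  move (.place 1 2)
    (move (.place 9 12) (wins [[nw]] nil) <| wins [[w, ne], [nw], [s, nw], [w, nw]] nil) <|
  move (.place 9 12)
    (wins [[nw]] <|
      move (.place 2 3)
        (threatC4 ne <| move (.place 4 5) <|
          threatE6 ne <| move (.place 6 7) <|
          threatG8 ne fun alt => move (.place 8 9) (threatI10 id) <|
            move (.place 6 7)
              (wins [[nw, ne, ne], [nw, nw, ne], [nw, ne]] <|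
                move (.place 8 6) (wins [[w, nw, ne, ne], [w, n, n, nw], [w, nw, nw, ne],
                  [w, nw, ne], [nw, ne, ne], [ne, ne], [ne]] nil) <|
                wins [[ne, ne], [ne]] nil) alt) nil) <|
  wins [[w, ne]] <| goal nil

/-- Betty's plan from `P2` after any move other than d5. -/
def bettyPlan : Plan :=
  wins [[ne, se, s], [ne, se, sw], [se, s]] <|
  move (.place 3 6)
    (wins [[w, se, se, s], [w, se, se, sw], [w, se, s], [sw, e, se, s], [se, se, s], [se, s]] <|
      move (.place 2 4) (wins [[s, se], [se]] nil) <|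
      wins [[s], [e, se, s], [se, se, sw]] nil) <|
  move (.place 2 4) (wins [[s, se], [se]] nil) nil

/-- The set of chaps of `P0`, together with the given ones. -/
def withP0 (l : List (ℕ × ℕ)) : ℕ :=
  mask ([(3, 1), (3, 2), (3, 5), (3, 7), (3, 9), (3, 10), (3, 11), (3, 12), (4, 6), (5, 4), (5, 11),
    (5, 12), (6, 1), (6, 2), (6, 9), (7, 7), (8, 1), (8, 2), (8, 3), (8, 4), (8, 6), (8, 8),
    (8, 11), (8, 12)] ++ l)

/-- A position with Alfred to move, his move and his plan after Betty's reply. -/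
structure Entry where
  ball : ℕ
  chaps : ℕ
  move : Mv
  plan : Plan

/-- The positions with Alfred to move through which the game goes in a loop. -/
def loop : List Entry :=
  [⟨code 1 2, withP0 [], .place 2 3, threatC4 ne goal⟩,
    ⟨code 1 2, withP0 [(2, 3), (3, 4)], .place 4 5, threatE6 ne goal⟩,
    ⟨code 1 2, withP0 [(2, 3), (3, 4), (4, 5), (5, 6)], .place 6 7, threatG8 ne goal⟩,
    ⟨code 1 2, withP0 [(2, 3), (3, 4), (4, 5), (5, 6), (6, 7), (7, 8)], .place 8 9,
      threatI10 goal⟩,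
    ⟨code 1 2, withP0 [(2, 3), (3, 4), (4, 5), (5, 6), (6, 7), (7, 8), (8, 9), (9, 10)],
      .jump [ne], afterJump⟩,
    ⟨code 10 11, withP0 [(9, 10)], .place 8 9, threatG8 sw goal⟩,
    ⟨code 10 11, withP0 [(9, 10), (8, 9), (7, 8)], .place 6 7, threatE6 sw goal⟩,
    ⟨code 10 11, withP0 [(9, 10), (8, 9), (7, 8), (6, 7), (5, 6)], .place 4 5,
      threatC4 sw goal⟩,
    ⟨code 10 11, withP0 [(9, 10), (8, 9), (7, 8), (6, 7), (5, 6), (4, 5), (3, 4)], .place 2 3,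
      afterLoop⟩]

end Loop

/-- The positions of the loop as goals. -/
def loopGoals : List (ℕ × ℕ) := loop.map fun x => (x.ball, x.chaps)

/-- Check that Alfred does not lose from a position of the loop. -/
def Entry.check (x : Entry) : Bool :=
  inside x.ball && (!wonAt true x.ball && (!wonAt false x.ball &&
    (Nat.beq (board ||| x.chaps) board && (consistent (fun b O =>
      checkMove true (Phutball.check true loopGoals x.plan) b O x.move) x.ball x.chaps).isSome)))

/-- Check that Betty wins from `P2` after any move of Alfred other than the one which leads to the
given position. -/
def checkOthers (x : ℕ × ℕ) (b O : ℕ) : Option ℕ :=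
  if Nat.beq x.1 b && Nat.beq x.2 O then some ((board ||| O) ^^^ O)
  else check false [] bettyPlan b O

theorem loop_check : loop.all Entry.check = true := by decide +kernel

theorem exists_forcesIn_of_mem_loop {s : PState} (hs : s ∈ positions true loopGoals) :
    s.turn = true ∧ winner 12 s = none ∧ ∃ t, MoveRel 12 10 s t ∧
      ∃ k, ForcesIn 12 10 true (positions true loopGoals) k t := by
  obtain ⟨_, hx, rfl⟩ := hs
  obtain ⟨x, hmem, rfl⟩ := List.mem_map.1 hx
  have h := List.all_eq_true.1 loop_check x hmem
  simp only [Entry.check, Bool.and_eq_true, Bool.not_eq_true', Nat.beq_eq] at h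
  obtain ⟨hb, h₁, h₂, hO, h⟩ := h
  obtain ⟨R, h⟩ := Option.isSome_iff_exists.1 h
  obtain ⟨h, hR⟩ := consistent_eq_some h
  obtain ⟨t, hm, ht⟩ := (checkMove_sound (check_sound loopGoals x.plan) (fun _ => .won) x.move
    x.ball x.chaps R _ h (fits_points hO hR) hb h₁ h₂).exists_forcesIn
  exact ⟨rfl, winner_eq_none.2 ⟨h₁, h₂⟩, t, hm, _, ht⟩

theorem lost_position {p : Player} {ev : ℕ → ℕ → Option ℕ} {Q : PState → Prop} {x : ℕ × ℕ}
    (hev : Sound p ev Q) (hQ : ∀ t, winner 12 t = some p → Q t)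
    (h : (inside x.1 && (!wonAt p x.1 && (!wonAt (!p) x.1 && (Nat.beq (board ||| x.2) board &&
      (consistent (checkOpp p ev) x.1 x.2).isSome)))) = true) :
    Lost p Q (position (!p) x) := by
  simp only [Bool.and_eq_true, Bool.not_eq_true', Nat.beq_eq] at h
  obtain ⟨hb, h₁, h₂, hO, h⟩ := h
  obtain ⟨R, h⟩ := Option.isSome_iff_exists.1 h
  obtain ⟨h, hR⟩ := consistent_eq_some h
  exact checkOpp_sound hev hQ h (fits_points hO hR) hb h₁ h₂

theorem checkOthers_sound (x : ℕ × ℕ) : Sound false (checkOthers x) fun t =>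
    t = position false x ∨ ∃ k, ForcesIn 12 10 false ∅ k t := by
  intro b O R C h hC hb h₁ h₂
  rw [checkOthers] at h
  split_ifs at h with hx
  · cases h
    simp only [Bool.and_eq_true, Nat.beq_eq] at hx
    obtain ⟨rfl, rfl⟩ := hx
    exact .inl (by rw [hC.eq_points]; rfl)
  · have h := check_sound [] bettyPlan b O R C h hC hb h₁ h₂
    have hG : positions false [] = ∅ := by simp [positions]
    exact .inr ⟨_, hG ▸ h⟩

/-- The ball and the chaps of `P2`. -/
def p2 : ℕ × ℕ := (code 1 2, withP0 [(2, 3), (3, 4)])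

/-- The ball and the chaps of `P2_d5`. -/
def p2d5 : ℕ × ℕ := (code 1 2, withP0 [(2, 3), (3, 4), (4, 5)])

theorem points_p2 : points p2.2 = P2.chaps := by decide +kernel

theorem points_p2d5 : points p2d5.2 = P2_d5.chaps := by decide +kernel

theorem position_p2 : position true p2 = P2 := by
  rw [position, points_p2]
  rfl

theorem position_p2d5 : position false p2d5 = P2_d5 := by
  rw [position, points_p2d5]
  rfl

theorem lost_P2_d5 : Lost true
    (ForcesIn 12 10 true (positions true loopGoals) (threatE6 northeast .goal).depth) P2_d5 := by
  rw [← position_p2d5]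
  exact lost_position (check_sound loopGoals (threatE6 northeast .goal)) (fun _ => .won)
    (by decide +kernel)

theorem lost_P2 : Lost false
    (fun t => t = P2_d5 ∨ ∃ k, ForcesIn 12 10 false ∅ k t) P2 := by
  rw [← position_p2, ← position_p2d5]
  exact lost_position (checkOthers_sound p2d5) (fun _ h => .inr ⟨0, .won h⟩) (by decide +kernel)

end Phutball

/-- From `P2`, placing a chap at d5 is Alfred's unique non-losing move:
it is a legal move; after it, Betty has no winning strategy from the resulting
position; and every other legal move of Alfred from `P2` leads to a position
from which Betty has a winning strategy. -/
theorem P2_unique_nonlosing :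
    MoveRel 12 10 P2 P2_d5 ∧
    ¬ WinsFrom 12 10 false P2_d5 ∧
    ∀ t, MoveRel 12 10 P2 t → t ≠ P2_d5 → WinsFrom 12 10 false t := by
  refine ⟨⟨rfl, .inl ⟨(4, 5), by norm_num [OnBoard], by decide, by decide, rfl, rfl⟩⟩,
    Phutball.lost_P2_d5.forcesIn.not_winsFrom fun _ => Phutball.exists_forcesIn_of_mem_loop,
    fun t ht hne => ?_⟩
  obtain ⟨k, hk⟩ := (Phutball.lost_P2.forall_move t ht).resolve_left hne
  exact hk.winsFrom
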